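/- Let L be a subgroup of ℤ² and let d ∈ ℕ. If L contains two ℤ-linearly independent nonnegative elements of degree ≤ d, then L contains two nonnegative elements of degree ≤ d that generate L as an additive group. (Consequently, for a representation of a finite abelian group with exactly two distinct nontrivial characters, β_field(G,V) = γ_field(G,V): the generation degree of a rank-2 sublattice of ℤ² equals its full-rank degree.) -/

import Mathlib

/-- The determinant of a pair of vectors in `ℤ²`. -/
def planarDet (a b : Fin 2 → ℤ) : ℤ := a 0 * b 1 - a 1 * b 0

theorem planarDet_ne_zero_of_linearIndependent {a b : Fin 2 → ℤ}
    (h : LinearIndependent ℤ ![a, b]) : planarDet a b ≠ 0 := by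
  intro hD
  unfold planarDet at hD
  rw [LinearIndependent.pair_iff] at h
  have h₁ := h (b 1) (-a 1) (by
    ext i
    fin_cases i <;> simp <;> linarith)
  have h₀ := h (b 0) (-a 0) (by
    ext i
    fin_cases i <;> simp <;> linarith)
  have ha : a = 0 := by
    ext i
    fin_cases i
    · simpa using h₀.2
    · simpa using h₁.2
  simpa [ha] using h 1 0

/-- The nonnegative elements of `L` of degree at most `d`. -/
def nonnegDegreeLE (L : AddSubgroup (Fin 2 → ℤ)) (d : ℕ) : Set (Fin 2 → ℤ) :=
  {a | a ∈ L ∧ (∀ i, 0 ≤ a i) ∧ ∑ i, a i ≤ (d : ℤ)}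

/-- A lattice point of the triangle with vertices `0`, `a`, `b` is nonnegative of degree at most
`d` if `a` and `b` are. -/
theorem mem_nonnegDegreeLE_of_triangle {L : AddSubgroup (Fin 2 → ℤ)} {d : ℕ}
    {a b y : Fin 2 → ℤ} (ha : a ∈ nonnegDegreeLE L d) (hb : b ∈ nonnegDegreeLE L d) (hy : y ∈ L)
    {D m n : ℤ} (hD : 0 < D) (hm : 0 ≤ m) (hn : 0 ≤ n) (hmn : m + n ≤ D)
    (h : ∀ i, D * y i = m * a i + n * b i) : y ∈ nonnegDegreeLE L d := by
  obtain ⟨-, ha₀, had⟩ := ha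
  obtain ⟨-, hb₀, hbd⟩ := hb
  refine ⟨hy, fun i => ?_, ?_⟩
  · refine nonneg_of_mul_nonneg_right ?_ hD
    rw [h i]
    exact add_nonneg (mul_nonneg hm (ha₀ i)) (mul_nonneg hn (hb₀ i))
  · refine le_of_mul_le_mul_left ?_ hD
    calc D * ∑ i, y i = m * ∑ i, a i + n * ∑ i, b i := by
          simp only [Finset.mul_sum, h, Finset.sum_add_distrib]
      _ ≤ m * d + n * d := by gcongr
      _ = (m + n) * d := by ring
      _ ≤ D * d := by gcongr

/-- If `a` and `b` do not generate `L`, then the triangle spanned by `a` and `b` contains a lattice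
point which, together with `a` or `b`, spans a parallelogram of smaller positive area. -/
theorem exists_planarDet_lt {L : AddSubgroup (Fin 2 → ℤ)} {d : ℕ} {a b x : Fin 2 → ℤ}
    (ha : a ∈ nonnegDegreeLE L d) (hb : b ∈ nonnegDegreeLE L d) (hD : 0 < planarDet a b)
    (hx : x ∈ L) (hx' : x ∉ AddSubgroup.closure {a, b}) :
    ∃ a' ∈ nonnegDegreeLE L d, ∃ b' ∈ nonnegDegreeLE L d,
      0 < planarDet a' b' ∧ planarDet a' b' < planarDet a b := by
  -- it suffices to find a nonzero lattice point of the triangle other than `a` and `b`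
  have key : ∀ y ∈ L, 0 ≤ planarDet y b → planarDet y b < planarDet a b →
      0 ≤ planarDet a y → planarDet a y < planarDet a b →
      planarDet y b + planarDet a y ≤ planarDet a b →
      (planarDet y b ≠ 0 ∨ planarDet a y ≠ 0) →
      ∃ a' ∈ nonnegDegreeLE L d, ∃ b' ∈ nonnegDegreeLE L d,
        0 < planarDet a' b' ∧ planarDet a' b' < planarDet a b := by
    intro y hy hm hmD hn hnD hmn hne
    have hyP := mem_nonnegDegreeLE_of_triangle ha hb hy hD hm hn hmn (by
      intro i
      fin_cases i <;> simp [planarDet] <;> ring)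
    rcases hne with h | h
    · exact ⟨y, hyP, b, hb, lt_of_le_of_ne hm h.symm, hmD⟩
    · exact ⟨a, ha, y, hyP, lt_of_le_of_ne hn h.symm, hnD⟩
  set D := planarDet a b with hDdef
  set p := planarDet x b / D with hp
  set q := planarDet a x / D with hq
  set y := x - p • a - q • b with hydef
  have hyL : y ∈ L :=
    L.sub_mem (L.sub_mem hx (L.zsmul_mem ha.1 p)) (L.zsmul_mem hb.1 q)
  have hyb : planarDet y b = planarDet x b % D := by
    rw [Int.emod_def, ← hp, hDdef]
    simp [planarDet, hydef]
    ring
  have hay : planarDet a y = planarDet a x % D := by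
    rw [Int.emod_def, ← hq, hDdef]
    simp [planarDet, hydef]
    ring
  have hm := Int.emod_nonneg (planarDet x b) hD.ne'
  have hmD := Int.emod_lt_of_pos (planarDet x b) hD
  have hn := Int.emod_nonneg (planarDet a x) hD.ne'
  have hnD := Int.emod_lt_of_pos (planarDet a x) hD
  rw [← hyb] at hm hmD
  rw [← hay] at hn hnD
  by_cases hmn : planarDet y b + planarDet a y ≤ D
  · refine key y hyL hm hmD hn hnD hmn ?_
    by_contra! hzero
    have hy0 : y = 0 := by
      ext i
      have h : D * y i = planarDet y b * a i + planarDet a y * b i := by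
        fin_cases i <;> simp [hDdef, planarDet] <;> ring
      rw [hzero.1, hzero.2] at h
      simpa [hD.ne'] using h
    have hxeq : x = p • a + q • b := by
      rw [hydef, sub_sub, sub_eq_zero] at hy0
      exact hy0
    exact hx' (AddSubgroup.mem_closure_pair.2 ⟨p, q, hxeq.symm⟩)
  · have h₁ : planarDet (a + b - y) b = D - planarDet y b := by
      simp only [hDdef, planarDet, Pi.sub_apply, Pi.add_apply]
      ring
    have h₂ : planarDet a (a + b - y) = D - planarDet a y := by
      simp only [hDdef, planarDet, Pi.sub_apply, Pi.add_apply]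
      ring
    apply key (a + b - y) (L.sub_mem (L.add_mem ha.1 hb.1) hyL) <;> omega

theorem exists_closure_pair_eq_of_planarDet_pos {L : AddSubgroup (Fin 2 → ℤ)} {d : ℕ}
    {a b : Fin 2 → ℤ} (ha : a ∈ nonnegDegreeLE L d) (hb : b ∈ nonnegDegreeLE L d)
    (hD : 0 < planarDet a b) :
    ∃ a ∈ nonnegDegreeLE L d, ∃ b ∈ nonnegDegreeLE L d, AddSubgroup.closure {a, b} = L := by
  induction hN : (planarDet a b).toNat using Nat.strong_induction_on generalizing a b with
  | _ N ih =>
    by_cases hL : L ≤ AddSubgroup.closure {a, b}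
    · refine ⟨a, ha, b, hb, le_antisymm ?_ hL⟩
      rw [AddSubgroup.closure_le]
      rintro z (rfl | rfl)
      exacts [ha.1, hb.1]
    · obtain ⟨x, hx, hx'⟩ := SetLike.not_le_iff_exists.1 hL
      obtain ⟨a', ha', b', hb', hpos, hlt⟩ := exists_planarDet_lt ha hb hD hx hx'
      exact ih _ (by omega) ha' hb' hpos rfl


/-- Let `L ≤ ℤ²` and `d ∈ ℕ`. If `L` contains two `ℤ`-linearly independent
nonnegative elements of degree `≤ d`, then `L` contains two nonnegative elements of degree
`≤ d` that generate `L` as an additive group. -/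
theorem stmt_9 (L : AddSubgroup (Fin 2 → ℤ)) (d : ℕ)
    (h : ∃ a b : Fin 2 → ℤ, a ∈ L ∧ b ∈ L ∧ LinearIndependent ℤ ![a, b] ∧
      (∀ i, 0 ≤ a i) ∧ (∀ i, 0 ≤ b i) ∧ (∑ i, a i) ≤ (d : ℤ) ∧ (∑ i, b i) ≤ (d : ℤ)) :
    ∃ a b : Fin 2 → ℤ, a ∈ L ∧ b ∈ L ∧ (∀ i, 0 ≤ a i) ∧ (∀ i, 0 ≤ b i) ∧
      (∑ i, a i) ≤ (d : ℤ) ∧ (∑ i, b i) ≤ (d : ℤ) ∧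
      AddSubgroup.closure {a, b} = L := by
  obtain ⟨a, b, ha, hb, hab, ha₀, hb₀, had, hbd⟩ := h
  have haP : a ∈ nonnegDegreeLE L d := ⟨ha, ha₀, had⟩
  have hbP : b ∈ nonnegDegreeLE L d := ⟨hb, hb₀, hbd⟩
  obtain ⟨a', ha', b', hb', hL⟩ : ∃ a ∈ nonnegDegreeLE L d, ∃ b ∈ nonnegDegreeLE L d,
      AddSubgroup.closure {a, b} = L := by
    rcases (planarDet_ne_zero_of_linearIndependent hab).lt_or_gt with hlt | hgt
    · refine exists_closure_pair_eq_of_planarDet_pos hbP haP ?_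
      unfold planarDet at hlt ⊢
      linarith
    · exact exists_closure_pair_eq_of_planarDet_pos haP hbP hgt
  exact ⟨a', b', ha'.1, hb'.1, ha'.2.1, hb'.2.1, ha'.2.2, hb'.2.2, hL⟩
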